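/- Let Ψ be a finite triangle-free simple graph. Let v and w be adjacent vertices of Ψ, let g ∈ C(Ψ), and set a = g·v·w·g⁻¹ (where v and w denote the corresponding canonical generators of C(Ψ)). Let b ∈ C(Ψ) with b ≠ a, and assume that either b = x·u·x⁻¹ for some x ∈ C(Ψ) and some canonical generator u, or b = x·u·u'·x⁻¹ for some x ∈ C(Ψ) and some canonical generators u, u' corresponding to adjacent vertices of Ψ. If a and b commute, then b = g·v·g⁻¹ or b = g·w·g⁻¹. -/

import Mathlib

/-- The defining relations of the right-angled Coxeter group of a simple graph:
squares of the generators, and squares of products of generators corresponding to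
adjacent vertices. -/
def racgRels {V : Type*} (G : SimpleGraph V) : Set (FreeGroup V) :=
  {r | (∃ v : V, r = FreeGroup.of v * FreeGroup.of v) ∨
    ∃ u v : V, G.Adj u v ∧ r = (FreeGroup.of u * FreeGroup.of v) ^ 2}

/-- The right-angled Coxeter group of a simple graph. -/
abbrev RACG {V : Type*} (G : SimpleGraph V) : Type _ := PresentedGroup (racgRels G)

/-- The canonical generator of the right-angled Coxeter group corresponding to a vertex. -/
def racgGen {V : Type*} (G : SimpleGraph V) (v : V) : RACG G := PresentedGroup.of v

/-- A reflection of a right-angled Coxeter group: a conjugate of a canonical generator. -/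
def IsReflection {V : Type*} (G : SimpleGraph V) (x : RACG G) : Prop :=
  ∃ (g : RACG G) (v : V), x = g * racgGen G v * g⁻¹

/-- Word length on a right-angled Coxeter group with respect to the canonical generators
(the generators are involutions, so words in the generators suffice). -/
noncomputable def racgLen {V : Type*} (G : SimpleGraph V) (x : RACG G) : ℕ :=
  sInf {n | ∃ l : List V, l.length = n ∧ (l.map (racgGen G)).prod = x}

/-- Words in the letters `X` without equal consecutive letters: the normal forms of
the free product of copies of `ℤ/2` indexed by `X`. -/
@[ext]
structure AltWord (X : Type*) where
  /-- The list of letters. -/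
  letters : List X
  isChain : letters.IsChain (· ≠ ·)

namespace AltWord

variable {X : Type*}

/-- The empty word. -/
def empty : AltWord X := ⟨[], List.isChain_nil⟩

/-- The word with one letter. -/
def single (x : X) : AltWord X := ⟨[x], List.isChain_singleton x⟩

open Classical in
/-- Left multiplication by the letter `x`, seen as an involution. -/
noncomputable def toggle (x : X) : AltWord X → AltWord X
  | ⟨[], _⟩ => single x
  | ⟨y :: t, h⟩ =>
    if hy : y = x then ⟨t, h.tail⟩ else ⟨x :: y :: t, List.isChain_cons_cons.2 ⟨Ne.symm hy, h⟩⟩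

theorem toggle_cons_self (x : X) (t : List X) (h : (x :: t).IsChain (· ≠ ·)) :
    toggle x ⟨x :: t, h⟩ = ⟨t, h.tail⟩ := by
  simp [toggle]

theorem toggle_cons_of_ne {x y : X} (hy : y ≠ x) (t : List X) (h : (y :: t).IsChain (· ≠ ·)) :
    toggle x ⟨y :: t, h⟩ = ⟨x :: y :: t, List.isChain_cons_cons.2 ⟨hy.symm, h⟩⟩ := by
  simp [toggle, hy]

theorem toggle_single (x : X) : toggle x (single x) = empty :=
  toggle_cons_self x [] _

theorem toggle_involutive (x : X) : Function.Involutive (toggle x) := by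
  rintro ⟨_ | ⟨y, t⟩, h⟩
  · exact toggle_single x
  · by_cases hy : y = x
    · subst hy
      rw [toggle_cons_self]
      cases t with
      | nil => rfl
      | cons z t =>
        exact toggle_cons_of_ne (List.isChain_cons_cons.1 h).1.symm _ _
    · rw [toggle_cons_of_ne hy, toggle_cons_self]

instance {G : Type*} [Group G] [MulAction G X] : MulAction G (AltWord X) where
  smul g l := ⟨l.letters.map (g • ·), by
    rw [List.isChain_map]
    exact l.isChain.imp fun _ _ h h' => h (smul_left_cancel g h')⟩
  one_smul l := AltWord.ext (by
    change l.letters.map ((1 : G) • ·) = l.letters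
    simp)
  mul_smul g h l := AltWord.ext (by
    change l.letters.map ((g * h) • ·) = (l.letters.map (h • ·)).map (g • ·)
    simp [Function.comp_def, mul_smul])

variable {G : Type*} [Group G] [MulAction G X]

theorem coe_smul (g : G) (l : AltWord X) : (g • l).letters = l.letters.map (g • ·) := rfl

theorem smul_single (g : G) (x : X) : g • single x = single (g • x) := rfl

theorem smul_toggle (g : G) (x : X) (l : AltWord X) :
    g • toggle x l = toggle (g • x) (g • l) := by
  obtain ⟨_ | ⟨y, t⟩, h⟩ := l
  · rfl
  · by_cases hy : y = x
    · subst hy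
      rw [toggle_cons_self]
      exact (toggle_cons_self (g • y) _ _).symm
    · rw [toggle_cons_of_ne hy]
      exact (toggle_cons_of_ne (fun h => hy (smul_left_cancel g h)) _ _).symm

/-- Two words are neighbours if one of them is obtained from the other by appending a letter. -/
def Neighbours (l m : AltWord X) : Prop := ∃ x, m.letters = l.letters ++ [x] ∨ l.letters = m.letters ++ [x]

theorem Neighbours.symm {l m : AltWord X} (h : Neighbours l m) : Neighbours m l := by
  obtain ⟨x, h⟩ := h
  exact ⟨x, h.symm⟩

theorem Neighbours.smul {l m : AltWord X} (h : Neighbours l m) (g : G) :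
    Neighbours (g • l) (g • m) := by
  obtain ⟨x, h | h⟩ := h
  · exact ⟨g • x, Or.inl (by simp [coe_smul, h])⟩
  · exact ⟨g • x, Or.inr (by simp [coe_smul, h])⟩

theorem neighbours_toggle_of_eq_append {l m : AltWord X} {y : X} (h : m.letters = l.letters ++ [y]) (x : X) :
    Neighbours (toggle x l) (toggle x m) := by
  obtain ⟨l, hl⟩ := l
  obtain ⟨m, hm⟩ := m
  obtain rfl : m = l ++ [y] := h
  cases l with
  | nil =>
    by_cases hy : y = x
    · subst hy
      exact ⟨y, Or.inr (by rw [show toggle y ⟨[] ++ [y], hm⟩ = empty from toggle_single y]; rfl)⟩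
    · exact ⟨y, Or.inl (by
        rw [show toggle x ⟨[] ++ [y], hm⟩ = _ from toggle_cons_of_ne hy [] hm]; rfl)⟩
  | cons z t =>
    by_cases hz : z = x
    · subst hz
      exact ⟨y, Or.inl (by
        rw [toggle_cons_self, show toggle z ⟨z :: t ++ [y], hm⟩ = _ from toggle_cons_self z _ hm]; rfl)⟩
    · exact ⟨y, Or.inl (by
        rw [toggle_cons_of_ne hz,
          show toggle x ⟨z :: t ++ [y], hm⟩ = _ from toggle_cons_of_ne hz _ hm]; rfl)⟩

theorem Neighbours.toggle {l m : AltWord X} (h : Neighbours l m) (x : X) :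
    Neighbours (toggle x l) (toggle x m) := by
  obtain ⟨y, h | h⟩ := h
  · exact neighbours_toggle_of_eq_append h x
  · exact (neighbours_toggle_of_eq_append h x).symm

/-- If `g` fixes the letter `x`, the only edge inverted by `toggle x ∘ g` is the one joining the
empty word to `x`. -/
theorem eq_empty_or_single_of_neighbours {g : G} {x : X} (hg : g • x = x) {l : AltWord X}
    (h : Neighbours l (AltWord.toggle x (g • l))) : l = empty ∨ l = single x := by
  obtain ⟨_ | ⟨y, t⟩, hl⟩ := l
  · exact Or.inl rfl
  right
  obtain ⟨z, h⟩ := h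
  by_cases hy : y = x
  · subst hy
    have e : (AltWord.toggle y (g • (⟨y :: t, hl⟩ : AltWord X))).letters = t.map (g • ·) := by
      have : g • (⟨y :: t, hl⟩ : AltWord X) = ⟨y :: t.map (g • ·), by
          have := (g • (⟨y :: t, hl⟩ : AltWord X)).isChain
          simpa [coe_smul, hg] using this⟩ := AltWord.ext (by simp [coe_smul, hg])
      rw [this, toggle_cons_self]
    rw [e] at h
    cases t with
    | nil => rfl
    | cons a t =>
      exfalso
      have hne := (List.isChain_cons_cons.1 hl).1
      rcases h with h | h
      · have := congrArg List.length h
        simp at this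
      · simp only [List.map_cons, List.cons_append, List.cons.injEq] at h
        exact hne (smul_left_cancel g (hg.trans h.1))
  · exfalso
    have hgy : g • y ≠ x := fun h' => hy (smul_left_cancel g (h'.trans hg.symm))
    have e : (AltWord.toggle x (g • (⟨y :: t, hl⟩ : AltWord X))).letters
        = x :: g • y :: t.map (g • ·) :=
      congrArg AltWord.letters (toggle_cons_of_ne hgy _ (g • (⟨y :: t, hl⟩ : AltWord X)).isChain)
    rw [e] at h
    rcases h with h | h
    · simp only [List.cons_append, List.cons.injEq] at h
      exact hy h.1.symm
    · have := congrArg List.length h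
      simp at this

end AltWord

namespace RACG

variable {V : Type*} {G : SimpleGraph V}

theorem gen_mul_self (v : V) : racgGen G v * racgGen G v = 1 :=
  PresentedGroup.one_of_mem (rels := racgRels G)
    (x := FreeGroup.of v * FreeGroup.of v) (Or.inl ⟨v, rfl⟩)

theorem gen_inv (v : V) : (racgGen G v)⁻¹ = racgGen G v :=
  inv_eq_of_mul_eq_one_left (gen_mul_self v)

theorem gen_commute {u v : V} (h : G.Adj u v) : Commute (racgGen G u) (racgGen G v) := by
  have h1 : (racgGen G u * racgGen G v) ^ 2 = 1 :=
    PresentedGroup.one_of_mem (rels := racgRels G)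
      (x := (FreeGroup.of u * FreeGroup.of v) ^ 2) (Or.inr ⟨u, v, h, rfl⟩)
  rw [pow_two] at h1
  have h2 := inv_eq_of_mul_eq_one_left h1
  rw [mul_inv_rev, gen_inv, gen_inv] at h2
  exact h2.symm

/-- The universal property of a right-angled Coxeter group. -/
def lift {H : Type*} [Group H] (f : V → H) (hf : ∀ v, f v * f v = 1)
    (hadj : ∀ u v, G.Adj u v → Commute (f u) (f v)) : RACG G →* H :=
  PresentedGroup.toGroup (f := f) (by
    rintro r (⟨v, rfl⟩ | ⟨u, v, h, rfl⟩)
    · simpa using hf v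
    · simp only [map_pow, map_mul, FreeGroup.lift_apply_of, (hadj u v h).mul_pow]
      simp [pow_two, hf])

@[simp]
theorem lift_gen {H : Type*} [Group H] (f : V → H) (hf : ∀ v, f v * f v = 1)
    (hadj : ∀ u v, G.Adj u v → Commute (f u) (f v)) (v : V) :
    lift f hf hadj (racgGen G v) = f v :=
  PresentedGroup.toGroup.of _

theorem hom_ext {H : Type*} [Group H] {f g : RACG G →* H}
    (h : ∀ v, f (racgGen G v) = g (racgGen G v)) : f = g :=
  PresentedGroup.ext h

theorem gen_induction {p : RACG G → Prop} (one : p 1)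
    (gen_mul : ∀ v b, p b → p (racgGen G v * b)) (b : RACG G) : p b := by
  have hb : b ∈ Subgroup.closure (Set.range (racgGen G)) := by
    have : Subgroup.closure (Set.range (racgGen G)) = ⊤ :=
      PresentedGroup.closure_range_of (racgRels G)
    rw [this]
    trivial
  induction hb using Subgroup.closure_induction_left with
  | one => exact one
  | mul_left x hx y _ ih =>
    obtain ⟨v, rfl⟩ := hx
    exact gen_mul v y ih
  | inv_mul_cancel x hx y _ ih =>
    obtain ⟨v, rfl⟩ := hx
    rw [gen_inv]
    exact gen_mul v y ih

open Classical in
/-- The parity of the number of occurrences of the generator `v`. -/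
noncomputable def parity (G : SimpleGraph V) (v : V) : RACG G →* ℤˣ :=
  lift (fun u => if u = v then -1 else 1) (fun u => by split_ifs <;> simp)
    fun _ _ _ => Commute.all _ _

theorem gen_ne_one (v : V) : racgGen G v ≠ 1 := fun h => by
  have := congrArg (parity G v) h
  simp [parity] at this

theorem gen_mul_gen_ne_one {u v : V} (h : G.Adj u v) : racgGen G u * racgGen G v ≠ 1 := fun h' => by
  have := congrArg (parity G u) h'
  simp [parity, h.ne'] at this

/-- The special subgroup generated by a set of vertices. -/
def special (G : SimpleGraph V) (A : Set V) : Subgroup (RACG G) :=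
  Subgroup.closure (racgGen G '' A)

theorem gen_mem_special {A : Set V} {u : V} (hu : u ∈ A) : racgGen G u ∈ special G A :=
  Subgroup.subset_closure ⟨u, hu, rfl⟩

open Classical in
/-- The retraction onto a special subgroup, killing all other generators. -/
noncomputable def retract (G : SimpleGraph V) (A : Set V) : RACG G →* RACG G :=
  lift (fun u => if u ∈ A then racgGen G u else 1)
    (fun u => by split_ifs <;> simp [gen_mul_self])
    fun u v h => by
      split_ifs
      exacts [gen_commute h, Commute.one_right _, Commute.one_left _, Commute.one_right _]

theorem retract_gen_of_mem {A : Set V} {u : V} (hu : u ∈ A) :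
    retract G A (racgGen G u) = racgGen G u := by
  simp [retract, hu]

theorem retract_gen_of_notMem {A : Set V} {u : V} (hu : u ∉ A) :
    retract G A (racgGen G u) = 1 := by
  simp [retract, hu]

theorem retract_mem (A : Set V) (b : RACG G) : retract G A b ∈ special G A := by
  induction b using gen_induction with
  | one => simp
  | gen_mul v b ih =>
    rw [map_mul]
    refine mul_mem ?_ ih
    by_cases hv : v ∈ A
    · rw [retract_gen_of_mem hv]
      exact gen_mem_special hv
    · rw [retract_gen_of_notMem hv]
      exact one_mem _

theorem retract_eq_self {A : Set V} {b : RACG G} (hb : b ∈ special G A) : retract G A b = b := by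
  have : special G A ≤ (retract G A).eqLocus (MonoidHom.id _) := by
    refine (Subgroup.closure_le _).2 ?_
    rintro _ ⟨u, hu, rfl⟩
    exact retract_gen_of_mem hu
  exact this hb

theorem retract_retract (A B : Set V) (b : RACG G) :
    retract G A (retract G B b) = retract G (A ∩ B) b := by
  refine DFunLike.congr_fun (f := (retract G A).comp (retract G B)) (hom_ext fun u => ?_) b
  by_cases hA : u ∈ A <;> by_cases hB : u ∈ B <;> simp [retract, hA, hB]

theorem mem_special_inter {A B : Set V} {b : RACG G} (hA : b ∈ special G A)
    (hB : b ∈ special G B) : b ∈ special G (A ∩ B) := by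
  rw [← retract_eq_self hA, ← retract_eq_self hB, retract_retract]
  exact retract_mem _ _

theorem eq_of_mem_special_pair {v w : V} (h : G.Adj v w) {b : RACG G}
    (hb : b ∈ special G {v, w}) :
    b = 1 ∨ b = racgGen G v ∨ b = racgGen G w ∨ b = racgGen G v * racgGen G w := by
  have hc : racgGen G w * racgGen G v = racgGen G v * racgGen G w := (gen_commute h).eq.symm
  have hv (c : RACG G) : racgGen G v * (racgGen G v * c) = c := by
    rw [← mul_assoc, gen_mul_self, one_mul]
  have key (u : V) (hu : u = v ∨ u = w) (y : RACG G) (ih : y = 1 ∨ y = racgGen G v ∨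
      y = racgGen G w ∨ y = racgGen G v * racgGen G w) : racgGen G u * y = 1 ∨
      racgGen G u * y = racgGen G v ∨ racgGen G u * y = racgGen G w ∨
      racgGen G u * y = racgGen G v * racgGen G w := by
    rcases hu with rfl | rfl <;> rcases ih with rfl | rfl | rfl | rfl
    · simp
    · simp [gen_mul_self]
    · simp
    · simp [hv]
    · simp
    · simp [hc]
    · simp [gen_mul_self]
    · simp [← mul_assoc, hc]
      simp [mul_assoc, gen_mul_self]
  induction hb using Subgroup.closure_induction_left with
  | one => simp
  | mul_left x hx y _ ih =>
    obtain ⟨u, hu, rfl⟩ := hx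
    exact key u hu y ih
  | inv_mul_cancel x hx y _ ih =>
    obtain ⟨u, hu, rfl⟩ := hx
    rw [gen_inv]
    exact key u hu y ih

section Link

variable (G) (v : V)

/-- The special subgroup generated by the neighbours of `v`. -/
abbrev link : Subgroup (RACG G) := special G (G.neighborSet v)

/-- The coset space of the special subgroup of the link of `v`; it indexes the conjugates of the
generator `v` by elements of the special subgroup of the complement of `v`. -/
abbrev LinkCoset : Type _ := RACG G ⧸ link G v

theorem link_le_centralizer : link G v ≤ Subgroup.centralizer {racgGen G v} := by
  refine (Subgroup.closure_le _).2 ?_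
  rintro _ ⟨u, hu, rfl⟩
  exact Subgroup.mem_centralizer_singleton_iff.2 (gen_commute (SimpleGraph.Adj.symm hu)).eq

/-- The trivial coset. -/
def baseCoset : LinkCoset G v := ((1 : RACG G) : RACG G ⧸ link G v)

variable {v} in
theorem gen_smul_baseCoset {u : V} (h : G.Adj v u) :
    racgGen G u • baseCoset G v = baseCoset G v := by
  refine (QuotientGroup.eq (s := link G v)).2 ?_
  simpa using gen_mem_special (G := G) (A := G.neighborSet v) h

open Classical in
/-- The permutation of words in cosets given by a generator: `v` multiplies by the base letter and
the other generators act on letters by translation. -/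
noncomputable def genPerm (u : V) : Equiv.Perm (AltWord (LinkCoset G v)) :=
  if u = v then (AltWord.toggle_involutive (baseCoset G v)).toPerm
  else MulAction.toPermHom (RACG G) _ (racgGen G u)

theorem genPerm_self (l : AltWord (LinkCoset G v)) :
    genPerm G v v l = l.toggle (baseCoset G v) := by
  simp [genPerm]

variable {v} in
theorem genPerm_of_ne {u : V} (h : u ≠ v) (l : AltWord (LinkCoset G v)) :
    genPerm G v u l = racgGen G u • l := by
  simp [genPerm, h]

variable {v} in
theorem commute_genPerm_self {u : V} (h : G.Adj v u) :
    Commute (genPerm G v v) (genPerm G v u) := by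
  ext1 l
  simp only [Equiv.Perm.mul_apply, genPerm_self, genPerm_of_ne G h.ne', AltWord.smul_toggle,
    gen_smul_baseCoset G h]

/-- The action of the group on words in cosets. -/
noncomputable def wordAction : RACG G →* Equiv.Perm (AltWord (LinkCoset G v)) :=
  lift (genPerm G v)
    (fun u => by
      ext1 l
      by_cases hu : u = v
      · subst hu
        simp [genPerm_self, AltWord.toggle_involutive _ l]
      · simp [genPerm_of_ne G hu, smul_smul, gen_mul_self])
    fun u u' h => by
      by_cases hu : u = v
      · subst hu
        exact commute_genPerm_self G h
      by_cases hu' : u' = v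
      · subst hu'
        exact (commute_genPerm_self G h.symm).symm
      ext1 l
      simp [genPerm_of_ne G hu, genPerm_of_ne G hu', smul_smul, (gen_commute h).eq]

theorem wordAction_self (l : AltWord (LinkCoset G v)) :
    wordAction G v (racgGen G v) l = l.toggle (baseCoset G v) := by
  simp [wordAction, genPerm_self]

variable {v} in
theorem wordAction_of_ne {u : V} (h : u ≠ v) (l : AltWord (LinkCoset G v)) :
    wordAction G v (racgGen G u) l = racgGen G u • l := by
  simp [wordAction, genPerm_of_ne G h]

theorem wordAction_retract (b : RACG G) (l : AltWord (LinkCoset G v)) :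
    wordAction G v (retract G {v}ᶜ b) l = retract G {v}ᶜ b • l := by
  induction b using gen_induction generalizing l with
  | one => simp
  | gen_mul u b ih =>
    by_cases hu : u = v
    · rw [map_mul, retract_gen_of_notMem (by simp [hu]), one_mul, ih]
    · rw [map_mul, retract_gen_of_mem (by simpa using hu), map_mul, Equiv.Perm.mul_apply, ih,
        wordAction_of_ne G hu, mul_smul]

theorem neighbours_wordAction {l m : AltWord (LinkCoset G v)} (h : l.Neighbours m) (b : RACG G) :
    (wordAction G v b l).Neighbours (wordAction G v b m) := by
  induction b using gen_induction with
  | one => simpa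
  | gen_mul u b ih =>
    simp only [map_mul, Equiv.Perm.mul_apply]
    by_cases hu : u = v
    · subst hu
      simpa only [wordAction_self] using ih.toggle _
    · simpa only [wordAction_of_ne G hu] using ih.smul _

/-- The conjugate of the generator `v` corresponding to a coset. -/
def cosetConj : LinkCoset G v → RACG G :=
  Quotient.lift (s := QuotientGroup.leftRel (link G v)) (fun h => h * racgGen G v * h⁻¹) (by
    intro a b hab
    have hc := Subgroup.mem_centralizer_singleton_iff.1
      (link_le_centralizer G v (QuotientGroup.leftRel_apply.1 hab))
    calc a * racgGen G v * a⁻¹ = a * (racgGen G v * (a⁻¹ * b)) * b⁻¹ := by group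
      _ = a * ((a⁻¹ * b) * racgGen G v) * b⁻¹ := by rw [hc]
      _ = b * racgGen G v * b⁻¹ := by group)

theorem cosetConj_smul (g : RACG G) (x : LinkCoset G v) :
    cosetConj G v (g • x) = g * cosetConj G v x * g⁻¹ := by
  induction x using QuotientGroup.induction_on with
  | H h =>
    change g * h * racgGen G v * (g * h)⁻¹ = g * (h * racgGen G v * h⁻¹) * g⁻¹
    group

theorem cosetConj_base : cosetConj G v (baseCoset G v) = racgGen G v := by
  change 1 * racgGen G v * 1⁻¹ = _
  simp

/-- The product of the conjugates of `v` corresponding to the letters of a word. -/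
def wordProd (l : AltWord (LinkCoset G v)) : RACG G := (l.letters.map (cosetConj G v)).prod

theorem wordProd_toggle (l : AltWord (LinkCoset G v)) :
    wordProd G v (l.toggle (baseCoset G v)) = racgGen G v * wordProd G v l := by
  obtain ⟨_ | ⟨y, t⟩, h⟩ := l
  · change ([baseCoset G v].map (cosetConj G v)).prod = _
    simp [cosetConj_base, wordProd]
  · by_cases hy : y = baseCoset G v
    · subst hy
      rw [AltWord.toggle_cons_self]
      simp [wordProd, cosetConj_base, ← mul_assoc, gen_mul_self]
    · rw [AltWord.toggle_cons_of_ne hy]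
      simp [wordProd, cosetConj_base]

theorem wordProd_smul (g : RACG G) (l : AltWord (LinkCoset G v)) :
    wordProd G v (g • l) = g * wordProd G v l * g⁻¹ := by
  obtain ⟨l, h⟩ := l
  change ((l.map (g • ·)).map (cosetConj G v)).prod = g * (l.map (cosetConj G v)).prod * g⁻¹
  clear h
  induction l with
  | nil => simp
  | cons x t ih =>
    simp only [List.map_cons, List.prod_cons, ih, cosetConj_smul]
    group

theorem wordProd_mul_retract (b : RACG G) :
    wordProd G v (wordAction G v b AltWord.empty) * retract G {v}ᶜ b = b := by
  induction b using gen_induction with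
  | one => simp [wordProd, AltWord.empty]
  | gen_mul u b ih =>
    simp only [map_mul, Equiv.Perm.mul_apply]
    by_cases hu : u = v
    · subst hu
      rw [wordAction_self, wordProd_toggle, retract_gen_of_notMem (by simp), one_mul, mul_assoc, ih]
    · rw [wordAction_of_ne G hu, wordProd_smul, retract_gen_of_mem (by simpa using hu)]
      conv_rhs => rw [← ih]
      group

variable {v}

/-- An element fixing both ends of the base edge lies in the special subgroup of the link. -/
theorem mem_link_of_fixes {b : RACG G} (h₀ : wordAction G v b AltWord.empty = AltWord.empty)
    (h₁ : wordAction G v b (AltWord.single (baseCoset G v)) = AltWord.single (baseCoset G v)) :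
    b ∈ link G v := by
  have hb : retract G {v}ᶜ b = b := by
    have := wordProd_mul_retract G v b
    rwa [h₀, show wordProd G v AltWord.empty = 1 from rfl, one_mul] at this
  rw [← hb, wordAction_retract, hb, AltWord.smul_single] at h₁
  have h₂ : b • baseCoset G v = baseCoset G v := by
    simpa [AltWord.single] using congrArg AltWord.letters h₁
  have h₃ := (QuotientGroup.eq (s := link G v)).1 h₂
  simpa using h₃

/-- The centralizer of a rotation lies in the special subgroup of the star of `v`. -/
theorem mem_star_of_commute {w : V} (h : G.Adj v w) {b : RACG G}
    (hb : Commute (racgGen G v * racgGen G w) b) :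
    b ∈ special G (insert v (G.neighborSet v)) := by
  have hle : link G v ≤ special G (insert v (G.neighborSet v)) :=
    Subgroup.closure_mono (Set.image_mono (Set.subset_insert _ _))
  have hrot (l : AltWord (LinkCoset G v)) : wordAction G v (racgGen G v * racgGen G w) l =
      (racgGen G w • l).toggle (baseCoset G v) := by
    rw [map_mul, Equiv.Perm.mul_apply, wordAction_self, wordAction_of_ne G h.ne']
  have hswap (c : RACG G) (hc : Commute (racgGen G v * racgGen G w) c) :
      wordAction G v c (AltWord.single (baseCoset G v)) =
        (racgGen G w • wordAction G v c AltWord.empty).toggle (baseCoset G v) := by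
    rw [← hrot, ← Equiv.Perm.mul_apply, ← map_mul, hc.eq, map_mul, Equiv.Perm.mul_apply, hrot]
    rfl
  have hfix (c : RACG G) (hc : Commute (racgGen G v * racgGen G w) c)
      (h₀ : wordAction G v c AltWord.empty = AltWord.empty) : c ∈ link G v := by
    refine mem_link_of_fixes G h₀ ?_
    rw [hswap c hc, h₀]
    rfl
  have hnb := neighbours_wordAction G v
    (l := AltWord.empty) (m := AltWord.single (baseCoset G v)) ⟨baseCoset G v, Or.inl rfl⟩ b
  rw [hswap b hb] at hnb
  rcases AltWord.eq_empty_or_single_of_neighbours (gen_smul_baseCoset G h) hnb with h₀ | h₀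
  · exact hle (hfix b hb h₀)
  · have hv : Commute (racgGen G v * racgGen G w) (racgGen G v) :=
      (Commute.refl _).mul_left (gen_commute h.symm)
    have hmem := hle (hfix (racgGen G v * b) (hv.mul_right hb) (by
      rw [map_mul, Equiv.Perm.mul_apply, h₀, wordAction_self, AltWord.toggle_single]))
    exact (Subgroup.mul_mem_cancel_left _ (gen_mem_special (Set.mem_insert _ _))).1 hmem

end Link

theorem star_inter_star (hG : G.CliqueFree 3) {v w : V} (h : G.Adj v w) :
    insert v (G.neighborSet v) ∩ insert w (G.neighborSet w) ⊆ {v, w} := by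
  classical
  rintro u ⟨rfl | hu, rfl | hu'⟩
  · simp
  · simp
  · simp
  · exact (hG {v, w, u} (SimpleGraph.is3Clique_triple_iff.2 ⟨h, hu, hu'⟩)).elim

theorem eq_of_commute_rotation (hG : G.CliqueFree 3) {v w : V} (h : G.Adj v w) {b : RACG G}
    (hb : Commute (racgGen G v * racgGen G w) b) :
    b = 1 ∨ b = racgGen G v ∨ b = racgGen G w ∨ b = racgGen G v * racgGen G w :=
  eq_of_mem_special_pair h (Subgroup.closure_mono (Set.image_mono (star_inter_star hG h))
    (mem_special_inter (mem_star_of_commute G h hb)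
      (mem_star_of_commute G h.symm (by rwa [← (gen_commute h).eq]))))

end RACG

theorem racg_commute_with_rotation {V : Type*} [Fintype V]
    (Ψ : SimpleGraph V) (hΨ : Ψ.CliqueFree 3)
    (v w : V) (hvw : Ψ.Adj v w) (g : RACG Ψ)
    (a : RACG Ψ) (ha : a = g * racgGen Ψ v * racgGen Ψ w * g⁻¹)
    (b : RACG Ψ) (hb : b ≠ a)
    (hbr : (∃ (x : RACG Ψ) (u : V), b = x * racgGen Ψ u * x⁻¹) ∨
      ∃ (x : RACG Ψ) (u u' : V), Ψ.Adj u u' ∧ b = x * racgGen Ψ u * racgGen Ψ u' * x⁻¹)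
    (hcomm : Commute a b) :
    b = g * racgGen Ψ v * g⁻¹ ∨ b = g * racgGen Ψ w * g⁻¹ := by
  have hb1 : b ≠ 1 := by
    rcases hbr with ⟨x, u, rfl⟩ | ⟨x, u, u', hu, rfl⟩
    · rw [Ne, conj_eq_one_iff]
      exact RACG.gen_ne_one u
    · rw [mul_assoc x, Ne, conj_eq_one_iff]
      exact RACG.gen_mul_gen_ne_one hu
  have hb' : b = g * (g⁻¹ * b * g) * g⁻¹ := by group
  have hc : Commute (racgGen Ψ v * racgGen Ψ w) (g⁻¹ * b * g) := by
    have := (Commute.conj_iff g⁻¹).2 hcomm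
    rw [ha] at this
    convert this using 1 <;> group
  rcases RACG.eq_of_commute_rotation hΨ hvw hc with h | h | h | h <;> rw [h] at hb'
  · exact (hb1 (by simpa using hb')).elim
  · exact Or.inl hb'
  · exact Or.inr hb'
  · exact (hb (by rw [hb', ha]; group)).elim
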